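/- arXiv:2501.02679 — 3 statements merged into one kernel-verified Lean document; each statement's English description precedes it below -/
import Mathlib

section
/- Let T be a complete first-order theory in a language L. If M and N are models of T such that M admits an enumeration (b_i)_{i<α} that is a construction sequence over ∅ (with respect to types computed in M) and N admits an enumeration (c_i)_{i<β} that is a construction sequence over ∅ (with respect to types computed in N), then M and N are isomorphic as L-structures. -/
open FirstOrder FirstOrder.Language Set

universe u v w

/-- `b ≡_A b'`: the tuples `b` and `b'` satisfy the same first-order `L`-formulas with
parameters from `A` in `M`. -/
def SameType (L : FirstOrder.Language.{u, v}) {M : Type w} [L.Structure M] (A : Set M)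
    {ι : Type*} (b b' : ι → M) : Prop :=
  ∀ (m : ℕ) (φ : L.Formula (ι ⊕ Fin m)) (p : Fin m → M), (∀ k, p k ∈ A) →
    (φ.Realize (Sum.elim b p) ↔ φ.Realize (Sum.elim b' p))

/-- The formula `φ` with parameters `p` isolates the type of the tuple `b` over the
parameter set `P`. -/
def Isolates {L : FirstOrder.Language.{u, v}} {M : Type w} [L.Structure M] {ι : Type*} {m : ℕ}
    (φ : L.Formula (ι ⊕ Fin m)) (p : Fin m → M) (P : Set M) (b : ι → M) : Prop :=
  φ.Realize (Sum.elim b p) ∧ ∀ c : ι → M, φ.Realize (Sum.elim c p) → SameType L P c b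

/-- The type `tp(b/P)` is isolated: some formula with parameters from `P` isolates it. -/
def IsolatedType (L : FirstOrder.Language.{u, v}) {M : Type w} [L.Structure M] (P : Set M)
    {ι : Type*} (b : ι → M) : Prop :=
  ∃ (m : ℕ) (φ : L.Formula (ι ⊕ Fin m)) (p : Fin m → M),
    (∀ k, p k ∈ P) ∧ Isolates φ p P b

/-- `(b_i)` is a construction sequence over `A`: each `tp(b_i / A ∪ {b_j : j < i})` is
isolated. -/
def IsConstructionSequence (L : FirstOrder.Language.{u, v}) {M : Type w} [L.Structure M]
    (A : Set M) {ι : Type*} [LinearOrder ι] (b : ι → M) : Prop :=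
  ∀ i : ι, IsolatedType L (A ∪ b '' {j | j < i}) ![b i]

/-- `B ⫛^wo_A C`: the tuples `B` and `C` are weakly orthogonal over `A`. -/
def WeaklyOrthogonal (L : FirstOrder.Language.{u, v}) {M : Type w} [L.Structure M] (A : Set M)
    {ιB ιC : Type*} (B : ιB → M) (C : ιC → M) : Prop :=
  ∀ (B' : ιB → M) (C' : ιC → M), SameType L A B' B → SameType L A C' C →
    SameType L A (Sum.elim B' C') (Sum.elim B C)

/-- `f` is an elementary map on the subset `S` of `M`. -/
def IsElementaryMapOn (L : FirstOrder.Language.{u, v}) {M : Type w} [L.Structure M]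
    (S : Set M) (f : M → M) : Prop :=
  ∀ (n : ℕ) (φ : L.Formula (Fin n)) (a : Fin n → M), (∀ k, a k ∈ S) →
    (φ.Realize a ↔ φ.Realize (f ∘ a))

/-- `M` is strongly homogeneous: any two tuples with the same type over a set of parameters
are conjugate by an automorphism fixing those parameters pointwise. -/
def StronglyHomogeneous (L : FirstOrder.Language.{u, v}) (M : Type w) [L.Structure M] : Prop :=
  ∀ (P : Set M) (ι : Type w) (x y : ι → M), SameType L P x y →
    ∃ σ : M ≃[L] M, (∀ a ∈ P, σ a = a) ∧ ∀ i, σ (x i) = y i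

section Isolation

variable {L : FirstOrder.Language.{u, v}} {M : Type w} [L.Structure M]

/-- A formula with parameters in `P` defines a `P`-definable set. -/
theorem definable_setOf_realize {α β : Type*} {P : Set M} (φ : L.Formula (α ⊕ β)) {p : β → M}
    (hp : ∀ k, p k ∈ P) : P.Definable L {v : α → M | φ.Realize (Sum.elim v p)} := by
  rw [definable_iff_exists_formula_sum]
  refine ⟨φ.relabel (Sum.elim Sum.inr fun k => Sum.inl ⟨p k, hp k⟩), ?_⟩
  ext v
  simp only [Set.mem_ofPred_eq, Formula.realize_relabel]
  refine iff_of_eq (congrArg _ ?_)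
  ext (a | k) <;> rfl

/-- The fibre of a `P`-definable set over a tuple from `Q ⊇ P` is `Q`-definable. -/
theorem definable_fibre {α β : Type*} {P Q : Set M} (hPQ : P ⊆ Q) {Z : Set (α ⊕ β → M)}
    (hZ : P.Definable L Z) {e : β → M} (he : ∀ k, e k ∈ Q) :
    Q.Definable L {v : α → M | Sum.elim v e ∈ Z} := by
  rw [definable_iff_exists_formula_sum] at hZ ⊢
  obtain ⟨φ, rfl⟩ := hZ
  refine ⟨φ.relabel (Sum.elim (fun x : P => Sum.inl ⟨x, hPQ x.2⟩)
    (Sum.elim Sum.inr fun k => Sum.inl ⟨e k, he k⟩)), ?_⟩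
  ext v
  simp only [Set.mem_ofPred_eq, Formula.realize_relabel]
  refine iff_of_eq (congrArg _ ?_)
  ext (x | a | k) <;> rfl

/-- A set definable over `P` together with a tuple `e` is a fibre over `e` of a `P`-definable
set. -/
theorem exists_definable_fibre {α β : Type*} {P : Set M} {e : β → M} {Z : Set (α → M)}
    (hZ : (P ∪ range e).Definable L Z) :
    ∃ Z' : Set (α ⊕ β → M), P.Definable L Z' ∧ Z = {v | Sum.elim v e ∈ Z'} := by
  classical
  obtain ⟨φ, rfl⟩ := definable_iff_exists_formula_sum.1 hZ
  have hg : ∀ x : ↥(P ∪ range e), ∃ y : P ⊕ (α ⊕ β),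
      ∀ v : α → M, Sum.elim (fun z : P => (z : M)) (Sum.elim v e) y = x := by
    rintro ⟨x, hx | ⟨k, rfl⟩⟩
    · exact ⟨Sum.inl ⟨x, hx⟩, fun v => rfl⟩
    · exact ⟨Sum.inr (Sum.inr k), fun v => rfl⟩
  choose g hg using hg
  refine ⟨_, definable_iff_exists_formula_sum.2
    ⟨φ.relabel (Sum.elim g fun a => Sum.inr (Sum.inl a)), rfl⟩, ?_⟩
  ext v
  simp only [Set.mem_ofPred_eq, Formula.realize_relabel]
  refine iff_of_eq (congrArg _ ?_)
  ext (x | a)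
  · exact (hg x v).symm
  · rfl

/-- Bounded universal quantification preserves definability. -/
theorem definable_forall_mem {α β : Type*} [Finite β] {P : Set M} {E Z : Set (α ⊕ β → M)}
    (hE : P.Definable L E) (hZ : P.Definable L Z) :
    P.Definable L {v : α → M | ∀ z : β → M, Sum.elim v z ∈ E → Sum.elim v z ∈ Z} := by
  have := (hE.compl.union hZ).forall_of_finite
  simpa only [mem_union, mem_compl_iff, ← imp_iff_not_or] using! this

/-- The set `D` is an atom of the algebra of `P`-definable sets below the tuple `t`, except that
`D` itself is not required to be `P`-definable. -/
def IsAtomAt (L : FirstOrder.Language.{u, v}) {M : Type w} [L.Structure M] {α : Type*}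
    (P : Set M) (D : Set (α → M)) (t : α → M) : Prop :=
  t ∈ D ∧ ∀ Z : Set (α → M), P.Definable L Z → t ∈ Z → D ⊆ Z

/-- The tuple `t` lies in an atom of the algebra of `P`-definable sets. -/
def LiesInAtom (L : FirstOrder.Language.{u, v}) {M : Type w} [L.Structure M] {α : Type*}
    (P : Set M) (t : α → M) : Prop :=
  ∃ D : Set (α → M), P.Definable L D ∧ IsAtomAt L P D t

theorem IsolatedType.liesInAtom {α : Type*} {P : Set M} {t : α → M}
    (h : IsolatedType L P t) : LiesInAtom L P t := by
  obtain ⟨m, φ, p, hp, hφ, hiso⟩ := h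
  refine ⟨_, definable_setOf_realize φ hp, hφ, fun Z hZ ht c hc => ?_⟩
  obtain ⟨A, hA, hZ⟩ := definable_iff_finitely_definable.1 hZ
  obtain ⟨ψ, rfl⟩ := definable_iff_exists_formula_sum.1 hZ
  let e := Fintype.equivFin (A : Set M)
  have key : ∀ v : α → M, (ψ.relabel (Sum.elim (fun x => Sum.inr (e x)) Sum.inl)).Realize
      (Sum.elim v fun k => ((e.symm k : (A : Set M)) : M)) ↔
        ψ.Realize (Sum.elim (fun x : (A : Set M) => (x : M)) v) := by
    intro v
    rw [Formula.realize_relabel]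
    refine iff_of_eq (congrArg _ ?_)
    ext (x | a) <;> simp
  exact (key c).1 ((hiso c hc _ _ _ fun k => hA (e.symm k).2).2 ((key t).2 ht))

theorem LiesInAtom.comp {α β : Type*} [Finite α] [Finite β] {P : Set M} {t : α → M}
    (h : LiesInAtom L P t) (f : β → α) : LiesInAtom L P (t ∘ f) := by
  obtain ⟨D, hD, ht, hmin⟩ := h
  refine ⟨_, hD.image_comp f, mem_image_of_mem _ ht, fun Z hZ htZ => ?_⟩
  exact image_subset_iff.2 (hmin _ (hZ.preimage_comp f) htZ)

theorem LiesInAtom.sumElim {α β : Type*} [Finite β] {P : Set M} {t : α → M} {s : β → M}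
    (ht : LiesInAtom L P t) (hs : LiesInAtom L (P ∪ range t) s) :
    LiesInAtom L P (Sum.elim t s) := by
  obtain ⟨D, hD, htD, hDmin⟩ := ht
  obtain ⟨E, hE, hsE, hEmin⟩ := hs
  obtain ⟨E', hE', rfl⟩ := exists_definable_fibre hE
  have hswap : ∀ {Z : Set (β ⊕ α → M)}, P.Definable L Z →
      P.Definable L ((fun g : α ⊕ β → M => g ∘ Sum.swap) ⁻¹' Z) :=
    fun hZ => hZ.preimage_comp _
  have hswap' : ∀ (v : α → M) (z : β → M), Sum.elim v z ∘ Sum.swap = Sum.elim z v := by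
    intro v z
    ext (x | x) <;> rfl
  refine ⟨_, (hD.preimage_comp (Sum.inl : α → α ⊕ β)).inter (hswap hE'), ⟨htD, ?_⟩, ?_⟩
  · simpa only [mem_preimage, hswap', Set.mem_ofPred_eq] using hsE
  · rintro Z hZ htsZ w ⟨hwD, hwE⟩
    have hZ' : P.Definable L {g : β ⊕ α → M | g ∘ Sum.swap ∈ Z} := hZ.preimage_comp _
    have hmem := hDmin _ (definable_forall_mem (hswap hE') hZ) (by
      intro z hz
      have hz' : z ∈ {v : β → M | Sum.elim v t ∈ E'} := by
        simpa only [mem_preimage, hswap', Set.mem_ofPred_eq] using hz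
      have := hEmin _ (definable_fibre subset_union_left hZ'
        (e := t) fun k => Or.inr (mem_range_self k)) (by
          have : Sum.elim s t ∘ Sum.swap = Sum.elim t s := by ext (x | x) <;> rfl
          simpa only [Set.mem_ofPred_eq, this] using htsZ) hz'
      have hcomp : Sum.elim z t ∘ Sum.swap = Sum.elim t z := by ext (x | x) <;> rfl
      simpa only [Set.mem_ofPred_eq, hcomp] using this) hwD
    have hw : Sum.elim (w ∘ Sum.inl) (w ∘ Sum.inr) = w := Sum.elim_comp_inl_inr w
    have := hmem (w ∘ Sum.inr)
    rw [hw] at this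
    exact this hwE

theorem liesInAtom_of_mem {P : Set M} {a : M} (ha : a ∈ P) : LiesInAtom L P ![a] := by
  have h := definable_setOf_realize (L := L) (P := P) (α := Fin 1) (β := Fin 1)
    ((Term.var (Sum.inl 0)).equal (Term.var (Sum.inr 0))) (p := fun _ => a) fun _ => ha
  refine ⟨_, h, by simp, fun Z hZ haZ c hc => ?_⟩
  have : c = ![a] := by
    ext k
    simpa [Subsingleton.elim k 0] using hc
  exact this ▸ haZ

end Isolation

section Construction

variable {L : FirstOrder.Language.{u, v}} {M : Type w} [L.Structure M]

/-- A choice, for every index of a construction sequence, of a formula isolating the type of the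
corresponding term, recorded by the set it defines and by the indices of its parameters. -/
structure ConstructionData (L : FirstOrder.Language.{u, v}) {M : Type w} [L.Structure M]
    {ι : Type*} [LinearOrder ι] (b : ι → M) where
  /-- The indices of the parameters. -/
  supp : ι → Finset ι
  /-- The set defined by the isolating formula. -/
  atom : ι → Set (Fin 1 → M)
  lt_of_mem : ∀ {i j}, j ∈ supp i → j < i
  definable : ∀ i, (b '' (supp i : Set ι)).Definable L (atom i)
  isAtomAt : ∀ i, IsAtomAt L (b '' {j | j < i}) (atom i) ![b i]

theorem exists_finset_definable_image {ι α : Type*} {b : ι → M} {X : Set ι} {Z : Set (α → M)}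
    (hZ : (b '' X).Definable L Z) :
    ∃ S : Finset ι, (S : Set ι) ⊆ X ∧ (b '' (S : Set ι)).Definable L Z := by
  classical
  obtain ⟨A, hA, hZ⟩ := definable_iff_finitely_definable.1 hZ
  obtain ⟨S, hS, rfl⟩ := Finset.subset_set_image_iff.1 hA
  exact ⟨S, hS, by simpa using hZ⟩

theorem IsConstructionSequence.nonempty_constructionData {ι : Type*} [LinearOrder ι] {b : ι → M}
    (h : IsConstructionSequence L (∅ : Set M) b) : Nonempty (ConstructionData L b) := by
  have : ∀ i, ∃ (S : Finset ι) (E : Set (Fin 1 → M)), (S : Set ι) ⊆ {j | j < i} ∧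
      (b '' (S : Set ι)).Definable L E ∧ IsAtomAt L (b '' {j | j < i}) E ![b i] := by
    intro i
    obtain ⟨E, hE, hat⟩ := (h i).liesInAtom
    rw [empty_union] at hE hat
    obtain ⟨S, hS, hSE⟩ := exists_finset_definable_image hE
    exact ⟨S, E, hS, hSE, hat⟩
  choose S E hS hSE hat using this
  exact ⟨⟨S, E, fun hj => hS _ hj, hSE, hat⟩⟩

namespace ConstructionData

variable {ι : Type*} [LinearOrder ι] {b : ι → M}

/-- A set of indices is closed if it contains the parameters of its isolating formulas. -/
def IsClosed (C : ConstructionData L b) (X : Set ι) : Prop :=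
  ∀ i ∈ X, (C.supp i : Set ι) ⊆ X

theorem IsClosed.union {C : ConstructionData L b} {X Y : Set ι} (hX : C.IsClosed X)
    (hY : C.IsClosed Y) : C.IsClosed (X ∪ Y) := by
  rintro i (hi | hi)
  · exact (hX i hi).trans subset_union_left
  · exact (hY i hi).trans subset_union_right

variable [WellFoundedLT ι]

theorem exists_finset_isClosed_mem (C : ConstructionData L b) (i : ι) :
    ∃ F : Finset ι, i ∈ F ∧ C.IsClosed (F : Set ι) := by
  classical
  induction i using WellFoundedLT.induction with
  | ind i ih =>
    choose F hF hFc using ih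
    let G := (C.supp i).attach.biUnion fun j => F j (C.lt_of_mem j.2)
    refine ⟨insert i G, Finset.mem_insert_self _ _, fun j hj => ?_⟩
    rw [Finset.coe_insert]
    rcases Finset.mem_insert.1 hj with rfl | hj
    · exact fun k hk => Or.inr
        (Finset.mem_biUnion.2 ⟨⟨k, hk⟩, Finset.mem_attach _ _, hF k _⟩)
    · obtain ⟨k, hk, hjk⟩ := Finset.mem_biUnion.1 hj
      exact fun l hl => Or.inr (Finset.mem_biUnion.2 ⟨k, hk, hFc _ _ _ hjk hl⟩)

theorem exists_finset_isClosed_superset (C : ConstructionData L b) (S : Finset ι) :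
    ∃ F : Finset ι, S ⊆ F ∧ C.IsClosed (F : Set ι) := by
  classical
  choose F hF hFc using C.exists_finset_isClosed_mem
  refine ⟨S.biUnion F, fun i hi => Finset.mem_biUnion.2 ⟨i, hi, hF i⟩, fun i hi j hj => ?_⟩
  obtain ⟨k, hk, hik⟩ := Finset.mem_biUnion.1 hi
  exact Finset.mem_biUnion.2 ⟨k, hk, hFc k i hik hj⟩

/-- The formula isolating the type of `b i` over the earlier terms also isolates its type over the
larger set obtained by adding a closed set of terms. -/
theorem isAtomAt_of_isClosed (C : ConstructionData L b) {X : Set ι} (hX : C.IsClosed X)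
    {i : ι} (hi : i ∉ X) : IsAtomAt L (b '' ({j | j < i} ∪ X)) (C.atom i) ![b i] := by
  let Q (S : Set ι) : Prop := ∀ Z : Set (Fin 1 → M), (b '' S).Definable L Z → ![b i] ∈ Z →
    C.atom i ⊆ Z
  have step : ∀ S : Set ι, S ⊆ {j | j < i} ∪ X →
      (∀ k ∈ S, k ∈ X → i < k → Q ({j | j < i} ∪ X ∩ {j | j < k})) → Q S := by
    intro S hSX hS Z hZ hbZ
    obtain ⟨S₀, hS₀, hZ⟩ := exists_finset_definable_image hZ
    by_cases hlt : (S₀ : Set ι) ⊆ {j | j < i}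
    · exact (C.isAtomAt i).2 Z (hZ.mono (image_mono hlt)) hbZ
    obtain ⟨k₀, hk₀, hk₀i⟩ := Set.not_subset.1 hlt
    have hne : S₀.Nonempty := ⟨k₀, hk₀⟩
    let k := S₀.max' hne
    have hkS₀ : k ∈ S₀ := S₀.max'_mem hne
    have hik : i ≤ k := (not_lt.1 hk₀i).trans (S₀.le_max' _ hk₀)
    have hkX : k ∈ X := (hSX (hS₀ hkS₀)).resolve_left (not_lt.2 hik)
    have hik : i < k := lt_of_le_of_ne hik fun h => hi (h ▸ hkX)
    set P := b '' ({j | j < i} ∪ X ∩ {j | j < k})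
    have hsub : b '' (S₀ : Set ι) ⊆ P ∪ range ![b k] := by
      rintro _ ⟨j, hj, rfl⟩
      rcases (S₀.le_max' j hj).lt_or_eq with hjk | hjk
      · exact Or.inl (mem_image_of_mem b ((hSX (hS₀ hj)).imp_right fun h => ⟨h, hjk⟩))
      · exact Or.inr ⟨0, by simp [hjk, k]⟩
    obtain ⟨Z', hZ', rfl⟩ := exists_definable_fibre (hZ.mono hsub)
    have hsupp : b '' (C.supp k : Set ι) ⊆ P :=
      image_mono fun j hj => Or.inr ⟨hX k hkX hj, C.lt_of_mem hj⟩
    have hPlt : P ⊆ b '' {j | j < k} :=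
      image_mono (union_subset (fun j hj => lt_trans hj hik) inter_subset_right)
    have hdef := definable_forall_mem (α := Fin 1)
      (((C.definable k).mono hsupp).preimage_comp (Sum.inr : Fin 1 → Fin 1 ⊕ Fin 1)) hZ'
    intro v hv
    refine hS k (hS₀ hkS₀) hkX hik _ hdef (fun z hz => ?_) hv ![b k] (C.isAtomAt k).1
    have hfib := definable_fibre hPlt (hZ'.preimage_comp Sum.swap) (e := ![b i])
      (fun _ => ⟨i, hik, by simp⟩)
    have hswap : ∀ x y : Fin 1 → M, Sum.elim x y ∘ Sum.swap = Sum.elim y x := by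
      intro x y
      ext (a | a) <;> rfl
    simp only [mem_preimage, hswap] at hfib
    exact (C.isAtomAt k).2 _ hfib hbZ hz
  suffices hQ : ∀ k, Q ({j | j < i} ∪ X ∩ {j | j < k}) from
    ⟨(C.isAtomAt i).1, step _ subset_rfl fun k _ _ _ => hQ k⟩
  intro k
  induction k using WellFoundedLT.induction with
  | ind k ih =>
    refine step _ (union_subset_union_right _ inter_subset_left) fun l hl hlX hil => ?_
    exact ih l (hl.resolve_left (not_lt.2 hil.le)).2

theorem liesInAtom_finset (C : ConstructionData L b) {X : Set ι} (hX : C.IsClosed X)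
    (G : Finset ι) (hG : C.IsClosed (X ∪ (G : Set ι))) :
    LiesInAtom L (b '' X) (fun g : G => b g) := by
  classical
  induction G using Finset.induction_on_max with
  | empty =>
    refine ⟨univ, definable_univ, mem_univ _, fun Z _ hZ v _ => ?_⟩
    exact (Subsingleton.elim _ v : (fun g : (∅ : Finset ι) => b g) = v) ▸ hZ
  | insert i G hlt ih =>
    have hG' : C.IsClosed (X ∪ (G : Set ι)) := by
      rintro j (hj | hj)
      · exact (hX j hj).trans subset_union_left
      · intro k hk
        have hki : k < i := (C.lt_of_mem hk).trans (hlt j hj)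
        rcases hG j (by simp [Finset.mem_coe.1 hj]) hk with h | h
        · exact Or.inl h
        · exact Or.inr (Finset.mem_of_mem_insert_of_ne h hki.ne)
    have hi : LiesInAtom L (b '' X ∪ range fun g : G => b g) ![b i] := by
      by_cases hiX : i ∈ X
      · exact liesInAtom_of_mem (Or.inl (mem_image_of_mem b hiX))
      have hiG : i ∉ X ∪ (G : Set ι) := by
        rintro (h | h)
        · exact hiX h
        · exact (hlt i h).false
      have hrange : b '' X ∪ range (fun g : G => b g) = b '' (X ∪ (G : Set ι)) := by
        rw [image_union, image_eq_range b (G : Set ι)]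
        rfl
      rw [hrange]
      have hat := C.isAtomAt_of_isClosed hG' hiG
      refine ⟨C.atom i, (C.definable i).mono (image_mono fun j hj => ?_), hat.1,
        fun Z hZ => hat.2 Z (hZ.mono (image_mono subset_union_right))⟩
      rcases hG i (by simp) hj with h | h
      · exact Or.inl h
      · exact Or.inr (Finset.mem_of_mem_insert_of_ne h (C.lt_of_mem hj).ne)
    have := ((ih hG').sumElim hi).comp fun g : ↥(insert i G) =>
      if h : (g : ι) ∈ G then Sum.inl (⟨g, h⟩ : G) else Sum.inr (0 : Fin 1)
    convert this using 1
    ext ⟨g, hg⟩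
    by_cases h : g ∈ G
    · simp [h]
    · obtain rfl := (Finset.mem_insert.1 hg).resolve_right h
      simp [h]

/-- A constructible structure is atomic over every closed set of terms. -/
theorem liesInAtom_of_isClosed (C : ConstructionData L b) (hb : Function.Surjective b) {X : Set ι}
    (hX : C.IsClosed X) {α : Type*} [Finite α] (t : α → M) : LiesInAtom L (b '' X) t := by
  classical
  cases nonempty_fintype α
  choose i hi using fun a => hb (t a)
  obtain ⟨F, hF, hFc⟩ := C.exists_finset_isClosed_superset (Finset.univ.image i)
  have := (C.liesInAtom_finset hX F (hX.union hFc)).comp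
    fun a => ⟨i a, hF (Finset.mem_image_of_mem i (Finset.mem_univ a))⟩
  convert this using 1
  ext a
  exact (hi a).symm

end ConstructionData

end Construction

section BackAndForth

theorem image_fst_preimage_swap {α β : Type*} (S : Set (α × β)) :
    Prod.fst '' (Prod.swap ⁻¹' S) = Prod.snd '' S := by
  rw [← image_swap_eq_preimage_swap, image_image]
  rfl

theorem image_snd_preimage_swap {α β : Type*} (S : Set (α × β)) :
    Prod.snd '' (Prod.swap ⁻¹' S) = Prod.fst '' S := by
  rw [← image_swap_eq_preimage_swap, image_image]
  rfl

/-- A family of subsets of `M`, closed under unions and with arbitrarily large finite members,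
over each of which `M` is atomic. -/
structure IsAtomicFamily (L : FirstOrder.Language.{u, v}) {M : Type w} [L.Structure M]
    (𝒞 : Set (Set M)) : Prop where
  sUnion_mem : ∀ 𝒮 ⊆ 𝒞, ⋃₀ 𝒮 ∈ 𝒞
  exists_finite : ∀ F : Set M, F.Finite → ∃ E ∈ 𝒞, E.Finite ∧ F ⊆ E
  liesInAtom : ∀ P ∈ 𝒞, ∀ {α : Type w} [Finite α] (t : α → M), LiesInAtom L P t

theorem ConstructionData.isAtomicFamily {L : FirstOrder.Language.{u, v}} {M : Type w}
    [L.Structure M] {ι : Type*} [LinearOrder ι] [WellFoundedLT ι] {b : ι → M}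
    (C : ConstructionData L b) (hb : Function.Surjective b) :
    IsAtomicFamily L {P | ∃ X, C.IsClosed X ∧ b '' X = P} where
  sUnion_mem 𝒮 h𝒮 := by
    refine ⟨⋃₀ {X | C.IsClosed X ∧ b '' X ∈ 𝒮}, ?_, ?_⟩
    · rintro i ⟨X, hX, hi⟩
      exact (hX.1 i hi).trans (subset_sUnion_of_mem hX)
    · ext m
      constructor
      · rintro ⟨i, ⟨X, hX, hi⟩, rfl⟩
        exact ⟨_, hX.2, mem_image_of_mem b hi⟩
      · rintro ⟨P, hP, hm⟩
        obtain ⟨X, hX, rfl⟩ := h𝒮 hP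
        obtain ⟨i, hi, rfl⟩ := hm
        exact ⟨i, ⟨X, ⟨hX, hP⟩, hi⟩, rfl⟩
  exists_finite F hF := by
    classical
    choose i hi using hb
    obtain ⟨G, hG, hGc⟩ := C.exists_finset_isClosed_superset (hF.toFinset.image i)
    refine ⟨_, ⟨G, hGc, rfl⟩, G.finite_toSet.image b, fun m hm => ?_⟩
    exact ⟨i m, hG (Finset.mem_image_of_mem i (hF.mem_toFinset.2 hm)), hi m⟩
  liesInAtom := by
    rintro _ ⟨X, hX, rfl⟩ α _ t
    exact C.liesInAtom_of_isClosed hb hX t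

variable {L : FirstOrder.Language.{u, v}} {M N : Type w} [L.Structure M] [L.Structure N]

/-- The relation `R` preserves and reflects all formulas. -/
def IsElementaryRel (L : FirstOrder.Language.{u, v}) {M N : Type w} [L.Structure M]
    [L.Structure N] (R : Set (M × N)) : Prop :=
  ∀ (n : ℕ) (φ : L.Formula (Fin n)) (e : Fin n → M × N), (∀ k, e k ∈ R) →
    (φ.Realize (fun k => (e k).1) ↔ φ.Realize (fun k => (e k).2))

variable {R : Set (M × N)}

namespace IsElementaryRel

theorem swap (h : IsElementaryRel L R) : IsElementaryRel L (Prod.swap ⁻¹' R) :=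
  fun n φ e he => (h n φ (fun k => (e k).swap) he).symm

theorem realize_iff (h : IsElementaryRel L R) {α : Type*} (φ : L.Formula α) {x : α → M}
    {y : α → N} (he : ∀ k, (x k, y k) ∈ R) : φ.Realize x ↔ φ.Realize y := by
  classical
  let q := Fintype.equivFin φ.freeVarFinset
  have := h _ (Formula.relabel q (φ.restrictFreeVar id : L.Formula φ.freeVarFinset))
    (fun k => (x (q.symm k), y (q.symm k))) fun k => he _
  simp only [Formula.realize_relabel] at this
  refine (BoundedFormula.realize_restrictFreeVar x ?_).symm.trans
    (this.trans (BoundedFormula.realize_restrictFreeVar y ?_)) <;> simp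

theorem fst_eq_iff (h : IsElementaryRel L R) {p q : M × N} (hp : p ∈ R) (hq : q ∈ R) :
    p.1 = q.1 ↔ p.2 = q.2 := by
  have := h.realize_iff (α := Bool) ((Term.var true).equal (Term.var false))
    (x := fun k => cond k p.1 q.1) (y := fun k => cond k p.2 q.2) (by
      rintro (_ | _)
      · exact hq
      · exact hp)
  simpa using this

theorem sUnion {𝒮 : Set (Set (M × N))} (hne : 𝒮.Nonempty) (hdir : DirectedOn (· ⊆ ·) 𝒮)
    (h : ∀ S ∈ 𝒮, IsElementaryRel L S) : IsElementaryRel L (⋃₀ 𝒮) := by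
  intro n φ e he
  obtain ⟨S, hS, heS⟩ := hdir.exists_mem_subset_of_finite_of_subset_sUnion hne
    (finite_range e) (range_subset_iff.2 he)
  exact h S hS n φ e fun k => heS (mem_range_self k)

theorem exists_insert {F : Set (M × N)} (hF : F.Finite) (h : IsElementaryRel L (R ∪ F))
    (hat : ∀ {α : Type w} [Finite α] (t : α → M), LiesInAtom L (Prod.fst '' R) t) (a : M) :
    ∃ d : N, IsElementaryRel L (insert (a, d) (R ∪ F)) := by
  have : Finite F := hF
  let P := Prod.fst '' R
  have hP : ∀ x : P, ∃ y : N, ((x : M), y) ∈ R := by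
    rintro ⟨_, ⟨⟨x, y⟩, hxy, rfl⟩⟩
    exact ⟨y, hxy⟩
  choose g hg using hP
  let t : F ⊕ PUnit.{w + 1} → M := Sum.elim (fun f => f.1.1) fun _ => a
  obtain ⟨D, hD, htD, hmin⟩ := hat t
  obtain ⟨φ, rfl⟩ := definable_iff_exists_formula_sum.1 hD
  obtain ⟨d, hd⟩ : ∃ d : N, φ.Realize (Sum.elim g (Sum.elim (fun f => f.1.2) fun _ => d)) := by
    let φ' : L.Formula ((P ⊕ F) ⊕ PUnit.{w + 1}) := φ.relabel (Equiv.sumAssoc _ _ _).symm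
    have h1 : (φ'.iExs PUnit).Realize
        (Sum.elim (fun x : P => (x : M)) fun f : F => f.1.1) := by
      refine Formula.realize_iExs.2 ⟨fun _ => a, ?_⟩
      rw [Formula.realize_relabel]
      have htD' : φ.Realize (Sum.elim (fun x : P => (x : M)) t) := htD
      convert htD' using 2
      ext (x | f | z) <;> rfl
    rw [h.realize_iff (φ'.iExs PUnit) (y := Sum.elim g fun f : F => f.1.2) (by
      rintro (x | f)
      · exact Or.inl (hg x)
      · exact Or.inr f.2)] at h1
    obtain ⟨z, hz⟩ := Formula.realize_iExs.1 h1
    refine ⟨z PUnit.unit, ?_⟩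
    rw [Formula.realize_relabel] at hz
    convert hz using 2
    ext (x | f | z) <;> rfl
  refine ⟨d, ?_⟩
  let s : F ⊕ PUnit.{w + 1} → N := Sum.elim (fun f => f.1.2) fun _ => d
  have key : ∀ ψ : L.Formula (P ⊕ (F ⊕ PUnit.{w + 1})),
      ψ.Realize (Sum.elim (fun x : P => (x : M)) t) → ψ.Realize (Sum.elim g s) := by
    intro ψ hψ
    have h1 := hmin _ (definable_iff_exists_formula_sum.2 ⟨ψ, rfl⟩) hψ
    have h2 : ((φ.imp ψ : L.Formula _).iAlls (F ⊕ PUnit.{w + 1})).Realize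
        (fun x : P => (x : M)) :=
      Formula.realize_iAlls.2 fun v hv => h1 hv
    rw [h.realize_iff _ (y := g) fun x => Or.inl (hg x)] at h2
    exact Formula.realize_iAlls.1 h2 s hd
  have key' : ∀ ψ : L.Formula (P ⊕ (F ⊕ PUnit.{w + 1})),
      ψ.Realize (Sum.elim (fun x : P => (x : M)) t) ↔ ψ.Realize (Sum.elim g s) :=
    fun ψ => ⟨key ψ, fun hs => by_contra fun ht => key ψ.not ht hs⟩
  intro n ψ e he
  have hz : ∀ k, ∃ z : P ⊕ (F ⊕ PUnit.{w + 1}),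
      Sum.elim (fun x : P => (x : M)) t z = (e k).1 ∧ Sum.elim g s z = (e k).2 := by
    intro k
    rcases he k with hk | hk | hk
    · exact ⟨Sum.inr (Sum.inr PUnit.unit), by rw [hk]; exact ⟨rfl, rfl⟩⟩
    · refine ⟨Sum.inl ⟨_, mem_image_of_mem _ hk⟩, rfl, ?_⟩
      exact (h.fst_eq_iff (Or.inl (hg _)) (Or.inl hk)).1 rfl
    · exact ⟨Sum.inr (Sum.inl ⟨e k, hk⟩), rfl, rfl⟩
  choose z hz1 hz2 using hz
  have := key' (ψ.relabel z)
  simp only [Formula.realize_relabel] at this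
  convert this using 2
  · exact funext fun k => (hz1 k).symm
  · exact funext fun k => (hz2 k).symm

end IsElementaryRel

/-- `S` is an elementary relation obtained from `R` by adding finitely many pairs. -/
def IsFiniteExtension (L : FirstOrder.Language.{u, v}) {M N : Type w} [L.Structure M]
    [L.Structure N] (R S : Set (M × N)) : Prop :=
  IsElementaryRel L S ∧ ∃ F : Set (M × N), F.Finite ∧ S = R ∪ F

theorem IsFiniteExtension.swap {S : Set (M × N)} (h : IsFiniteExtension L R S) :
    IsFiniteExtension L (Prod.swap ⁻¹' R) (Prod.swap ⁻¹' S) := by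
  obtain ⟨hS, F, hF, rfl⟩ := h
  exact ⟨hS.swap, _, hF.preimage Prod.swap_injective.injOn, rfl⟩

theorem IsFiniteExtension.exists_superset_finite {S : Set (M × N)}
    (h : IsFiniteExtension L R S)
    (hat : ∀ {α : Type w} [Finite α] (t : α → M), LiesInAtom L (Prod.fst '' R) t)
    {A : Set M} (hA : A.Finite) :
    ∃ S', IsFiniteExtension L R S' ∧ S ⊆ S' ∧ A ⊆ Prod.fst '' S' := by
  induction A, hA using Set.Finite.induction_on with
  | empty => exact ⟨S, h, subset_rfl, empty_subset _⟩
  | @insert a A _ _ ih =>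
    obtain ⟨S', ⟨hS', F, hF, rfl⟩, hSS', hA⟩ := ih
    obtain ⟨d, hd⟩ := hS'.exists_insert hF hat a
    refine ⟨_, ⟨hd, insert (a, d) F, hF.insert _, (union_insert ..).symm⟩,
      hSS'.trans (subset_insert _ _), ?_⟩
    rintro m (rfl | hm)
    · exact ⟨_, mem_insert _ _, rfl⟩
    · exact image_mono (subset_insert _ _) (hA hm)

theorem IsFiniteExtension.exists_superset_closed {S : Set (M × N)}
    (h : IsFiniteExtension L R S) {𝒞 : Set (Set M)} (h𝒞 : IsAtomicFamily L 𝒞)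
    (hR : Prod.fst '' R ∈ 𝒞) (a : M) :
    ∃ S', IsFiniteExtension L R S' ∧ S ⊆ S' ∧
      ∃ E ∈ 𝒞, a ∈ E ∧ Prod.fst '' S ⊆ E ∧ E ⊆ Prod.fst '' S' := by
  obtain ⟨-, F, hF, rfl⟩ := id h
  obtain ⟨E, hE, hEfin, hFE⟩ := h𝒞.exists_finite _ ((hF.image Prod.fst).insert a)
  obtain ⟨S', hS', hSS', hES'⟩ := h.exists_superset_finite (h𝒞.liesInAtom _ hR) hEfin
  refine ⟨S', hS', hSS', _, h𝒞.sUnion_mem {Prod.fst '' R, E} ?_, ?_, ?_, ?_⟩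
  · exact insert_subset hR (singleton_subset_iff.2 hE)
  · exact ⟨E, by simp, hFE (mem_insert _ _)⟩
  · rw [sUnion_pair, image_union]
    exact union_subset_union_right _ ((subset_insert _ _).trans hFE)
  · rw [sUnion_pair]
    exact union_subset (image_mono (subset_union_left.trans hSS')) hES'

namespace IsElementaryRel

theorem exists_superset_mem (h : IsElementaryRel L R) {𝒞 : Set (Set M)} {𝒟 : Set (Set N)}
    (h𝒞 : IsAtomicFamily L 𝒞) (h𝒟 : IsAtomicFamily L 𝒟) (hR : Prod.fst '' R ∈ 𝒞)
    (hR' : Prod.snd '' R ∈ 𝒟) (a : M) :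
    ∃ S, IsElementaryRel L S ∧ Prod.fst '' S ∈ 𝒞 ∧ Prod.snd '' S ∈ 𝒟 ∧ R ⊆ S ∧
      a ∈ Prod.fst '' S := by
  have step : ∀ S : {S // IsFiniteExtension L R S}, ∃ S' : {S // IsFiniteExtension L R S},
      S.1 ⊆ S'.1 ∧ (∃ E ∈ 𝒞, a ∈ E ∧ Prod.fst '' S.1 ⊆ E ∧ E ⊆ Prod.fst '' S'.1) ∧
        ∃ E ∈ 𝒟, Prod.snd '' S.1 ⊆ E ∧ E ⊆ Prod.snd '' S'.1 := by
    rintro ⟨S, hS⟩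
    obtain ⟨S₁, hS₁, hSS₁, E, hE, haE, hSE, hES₁⟩ := hS.exists_superset_closed h𝒞 hR a
    obtain ⟨d⟩ : Nonempty N := by
      obtain ⟨p, -⟩ := hES₁ haE
      exact ⟨p.2⟩
    obtain ⟨S₂, hS₂, hSS₂, E', hE', -, hSE', hES₂⟩ :=
      hS₁.swap.exists_superset_closed h𝒟 (by rwa [image_fst_preimage_swap]) d
    have hSS₂ : S₁ ⊆ Prod.swap ⁻¹' S₂ := fun p hp => hSS₂ hp
    refine ⟨⟨Prod.swap ⁻¹' S₂, hS₂.swap⟩, hSS₁.trans hSS₂,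
      ⟨E, hE, haE, hSE, hES₁.trans (image_mono hSS₂)⟩, E', hE', ?_, ?_⟩
    · rw [image_fst_preimage_swap] at hSE'
      exact (image_mono hSS₁).trans hSE'
    · have := image_fst_preimage_swap (Prod.swap ⁻¹' S₂)
      rw [← this]
      exact hES₂
  choose enl henl hC hD using step
  choose E hE haE hSE hES using hC
  choose E' hE' hSE' hES' using hD
  let S : ℕ → {S // IsFiniteExtension L R S} := fun n =>
    enl^[n] ⟨R, h, ∅, finite_empty, (union_empty R).symm⟩
  have hS : ∀ n, S (n + 1) = enl (S n) := fun n => Function.iterate_succ_apply' _ _ _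
  have hmono : Monotone fun n => (S n).1 := by
    refine monotone_nat_of_le_succ fun n => ?_
    rw [hS]
    exact henl _
  have hunion : Prod.fst '' (⋃ n, (S n).1) = ⋃₀ range fun n => E (S n) := by
    rw [image_iUnion, sUnion_range]
    refine subset_antisymm (iUnion_mono fun n => hSE _) (iUnion_subset fun n => ?_)
    exact (hES _).trans (hS n ▸ subset_iUnion (fun n => Prod.fst '' (S n).1) (n + 1))
  have hunion' : Prod.snd '' (⋃ n, (S n).1) = ⋃₀ range fun n => E' (S n) := by
    rw [image_iUnion, sUnion_range]
    refine subset_antisymm (iUnion_mono fun n => hSE' _) (iUnion_subset fun n => ?_)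
    exact (hES' _).trans (hS n ▸ subset_iUnion (fun n => Prod.snd '' (S n).1) (n + 1))
  refine ⟨⋃ n, (S n).1, ?_, ?_, ?_, subset_iUnion (fun n => (S n).1) 0, ?_⟩
  · rw [← sUnion_range]
    refine sUnion (range_nonempty _) (directedOn_range.2 hmono.directed_le) ?_
    rintro _ ⟨n, rfl⟩
    exact (S n).2.1
  · rw [hunion]
    exact h𝒞.sUnion_mem _ (range_subset_iff.2 fun n => hE _)
  · rw [hunion']
    exact h𝒟.sUnion_mem _ (range_subset_iff.2 fun n => hE' _)
  · rw [hunion]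
    exact ⟨_, mem_range_self 0, haE _⟩

/-- A total and surjective elementary relation yields an isomorphism. -/
theorem nonempty_equiv (h : IsElementaryRel L R) (hM : ∀ m, m ∈ Prod.fst '' R)
    (hN : ∀ n, n ∈ Prod.snd '' R) : Nonempty (M ≃[L] N) := by
  have hM' : ∀ m : M, ∃ n : N, (m, n) ∈ R := by
    intro m
    obtain ⟨⟨m, n⟩, hmn, rfl⟩ := hM m
    exact ⟨n, hmn⟩
  choose f hf using hM'
  let F : M ↪ₑ[L] N := ⟨f, fun n φ x => (h.realize_iff φ fun k => hf (x k)).symm⟩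
  have hsurj : Function.Surjective F := by
    intro n
    obtain ⟨⟨m, n⟩, hmn, rfl⟩ := hN n
    exact ⟨m, (h.fst_eq_iff (hf m) hmn).1 rfl⟩
  exact ⟨⟨Equiv.ofBijective F ⟨F.injective, hsurj⟩, fun g x => F.map_fun g x,
    fun r x => F.map_rel r x⟩⟩

end IsElementaryRel

/-- Structures carrying atomic families are isomorphic as soon as they are elementarily
equivalent. -/
theorem IsAtomicFamily.nonempty_equiv {𝒞 : Set (Set M)} {𝒟 : Set (Set N)}
    (h𝒞 : IsAtomicFamily L 𝒞) (h𝒟 : IsAtomicFamily L 𝒟)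
    (h : IsElementaryRel L (∅ : Set (M × N))) : Nonempty (M ≃[L] N) := by
  obtain ⟨R, -, hR⟩ := zorn_subset_nonempty
    {R : Set (M × N) | IsElementaryRel L R ∧ Prod.fst '' R ∈ 𝒞 ∧ Prod.snd '' R ∈ 𝒟} (by
      intro c hc hchain hne
      refine ⟨⋃₀ c, ⟨IsElementaryRel.sUnion hne hchain.directedOn fun S hS => (hc hS).1, ?_, ?_⟩,
        fun S hS => subset_sUnion_of_mem hS⟩
      · rw [image_sUnion]
        refine h𝒞.sUnion_mem _ ?_
        rintro _ ⟨S, hS, rfl⟩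
        exact (hc hS).2.1
      · rw [image_sUnion]
        refine h𝒟.sUnion_mem _ ?_
        rintro _ ⟨S, hS, rfl⟩
        exact (hc hS).2.2) ∅ ⟨h, by
      simpa using h𝒞.sUnion_mem ∅ (empty_subset _), by
      simpa using h𝒟.sUnion_mem ∅ (empty_subset _)⟩
  obtain ⟨hel, hR𝒞, hR𝒟⟩ := hR.prop
  refine hel.nonempty_equiv (fun m => ?_) fun n => ?_
  · obtain ⟨S, hS, hS𝒞, hS𝒟, hRS, hm⟩ := hel.exists_superset_mem h𝒞 h𝒟 hR𝒞 hR𝒟 m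
    rwa [hR.eq_of_subset ⟨hS, hS𝒞, hS𝒟⟩ hRS]
  · obtain ⟨S, hS, hS𝒟, hS𝒞, hRS, hn⟩ := hel.swap.exists_superset_mem h𝒟 h𝒞
      (by rwa [image_fst_preimage_swap]) (by rwa [image_snd_preimage_swap]) n
    rw [hR.eq_of_subset (t := Prod.swap ⁻¹' S)
      ⟨hS.swap, by rwa [image_fst_preimage_swap], by rwa [image_snd_preimage_swap]⟩
      fun p hp => hRS (a := p.swap) hp, image_snd_preimage_swap]
    exact hn

theorem isElementaryRel_empty {T : L.Theory} (hT : T.IsComplete) [Nonempty M] [Nonempty N]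
    (hM : M ⊨ T) (hN : N ⊨ T) : IsElementaryRel L (∅ : Set (M × N)) := by
  intro n φ e he
  obtain rfl : n = 0 := by
    rcases n with _ | n
    · rfl
    · exact (he 0).elim
  let σ : L.Sentence := Formula.relabel Fin.elim0 φ
  have hσ : ∀ (K : Type w) [L.Structure K] (x : Fin 0 → K), K ⊨ σ ↔ φ.Realize x := by
    intro K _ x
    rw [Sentence.Realize, Formula.realize_relabel]
    exact iff_of_eq (congrArg _ (Subsingleton.elim _ _))
  rw [← hσ M, ← hσ N, hT.realize_sentence_iff, hT.realize_sentence_iff]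

end BackAndForth

/-- Any two models of a complete theory that are enumerated by construction
sequences over `∅` are isomorphic. -/
theorem constructible_models_isomorphic
    {L : FirstOrder.Language.{u, v}} {M N : Type w}
    [L.Structure M] [L.Structure N] [Nonempty M] [Nonempty N]
    {T : L.Theory} (hT : T.IsComplete) (hMT : M ⊨ T) (hNT : N ⊨ T)
    {ι κ : Type*} [LinearOrder ι] [WellFoundedLT ι] [LinearOrder κ] [WellFoundedLT κ]
    {b : ι → M} {c : κ → N}
    (hbsurj : Function.Surjective b)
    (hbcon : IsConstructionSequence L (∅ : Set M) b)
    (hcsurj : Function.Surjective c)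
    (hccon : IsConstructionSequence L (∅ : Set N) c) :
    Nonempty (M ≃[L] N) := by
  obtain ⟨B⟩ := hbcon.nonempty_constructionData
  obtain ⟨C⟩ := hccon.nonempty_constructionData
  exact (B.isAtomicFamily hbsurj).nonempty_equiv (C.isAtomicFamily hcsurj)
    (isElementaryRel_empty hT hMT hNT)
end

section
/- Let M be a strongly homogeneous L-structure, A ⊆ M a set of parameters, and B, C, D tuples of elements of M. If D is weakly orthogonal to B over A and D is weakly orthogonal to C over A∪B, then D is weakly orthogonal to the concatenation (B,C) over A. -/
open FirstOrder FirstOrder.Language Set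

universe u v w

namespace SameType

variable {L : FirstOrder.Language.{u, v}} {M : Type w} [L.Structure M] {A : Set M}
  {ι ι' κ : Type*} {x y z : ι → M}

theorem symm (h : SameType L A x y) : SameType L A y x :=
  fun m φ p hp => (h m φ p hp).symm

theorem trans (h : SameType L A x y) (h' : SameType L A y z) : SameType L A x z :=
  fun m φ p hp => (h m φ p hp).trans (h' m φ p hp)

/-- Tuples of the same type over `A` agree on formulas whose parameters from `A` are indexed by
an arbitrary type. -/
theorem realize_iff (h : SameType L A x y) (φ : L.Formula (ι ⊕ κ)) (p : κ → M)
    (hp : ∀ k, p k ∈ A) :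
    φ.Realize (Sum.elim x p) ↔ φ.Realize (Sum.elim y p) := by
  classical
  let t : Finset κ := φ.freeVarFinset.toRight
  let e : t ≃ Fin t.card := t.equivFin
  let f : φ.freeVarFinset → ι ⊕ Fin t.card
    | ⟨Sum.inl i, _⟩ => Sum.inl i
    | ⟨Sum.inr k, hk⟩ => Sum.inr (e ⟨k, Finset.mem_toRight.2 hk⟩)
  have key (c : ι → M) : Formula.Realize (BoundedFormula.restrictFreeVar φ f)
      (Sum.elim c fun j => p (e.symm j)) ↔ φ.Realize (Sum.elim c p) := by
    refine BoundedFormula.realize_restrictFreeVar (v' := Sum.elim c p) ?_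
    rintro ⟨i | k, hk⟩ <;> simp [f]
  rw [← key x, ← key y]
  exact h _ _ _ fun _ => hp _

theorem comp (h : SameType L A x y) (f : ι' → ι) : SameType L A (x ∘ f) (y ∘ f) := by
  intro m φ p hp
  have := h m (φ.relabel (Sum.map f id)) p hp
  simpa [Formula.realize_relabel, Sum.elim_comp_map] using this

/-- Elements of the tuple `B` may be moved from the parameter set into the tuples. -/
theorem union_range_iff {B : κ → M} :
    SameType L (A ∪ range B) x y ↔ SameType L A (Sum.elim x B) (Sum.elim y B) := by
  refine ⟨fun h m φ p hp => ?_, fun h m φ p hp => ?_⟩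
  · have := h.realize_iff (φ.relabel (Equiv.sumAssoc ι κ (Fin m))) (Sum.elim B p) (by
      rintro (k | k)
      · exact Or.inr ⟨k, rfl⟩
      · exact Or.inl (hp k))
    have key (c : ι → M) : Sum.elim c (Sum.elim B p) ∘ Equiv.sumAssoc ι κ (Fin m) =
        Sum.elim (Sum.elim c B) p := by
      ext ((i | k) | j) <;> rfl
    simpa only [Formula.realize_relabel, key] using this
  · have hg (j : Fin m) : ∃ k : κ ⊕ A, Sum.elim B Subtype.val k = p j := by
      rcases hp j with ha | ⟨k, hk⟩
      · exact ⟨Sum.inr ⟨p j, ha⟩, rfl⟩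
      · exact ⟨Sum.inl k, hk⟩
    choose g hg using hg
    have key (c : ι → M) : Sum.elim (Sum.elim c B) (Subtype.val : A → M) ∘
        ((Equiv.sumAssoc ι κ A).symm ∘ Sum.map id g) = Sum.elim c p := by
      ext (i | j)
      · rfl
      · rw [Sum.elim_inr, ← hg j]
        rcases hj : g j with k | a <;> simp [hj]
    have := h.realize_iff (φ.relabel ((Equiv.sumAssoc ι κ A).symm ∘ Sum.map id g))
      Subtype.val Subtype.prop
    simpa only [Formula.realize_relabel, key] using this

theorem of_equiv (σ : M ≃[L] M) (hσ : ∀ a ∈ A, σ a = a) (x : ι → M) :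
    SameType L A x (σ ∘ x) := by
  intro m φ p hp
  have hp' : σ ∘ p = p := funext fun k => hσ _ (hp k)
  rw [← StrongHomClass.realize_formula σ φ, Sum.comp_elim, hp']

end SameType

/-- If `D ⫛^wo_A B` and `D ⫛^wo_{A∪B} C`, then `D ⫛^wo_A (B,C)`. -/
theorem weaklyOrthogonal_trans
    {L : FirstOrder.Language.{u, v}} {M : Type w} [L.Structure M]
    (hM : StronglyHomogeneous L M) (A : Set M)
    {ιB ιC ιD : Type w} (B : ιB → M) (C : ιC → M) (D : ιD → M)
    (h1 : WeaklyOrthogonal L A D B)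
    (h2 : WeaklyOrthogonal L (A ∪ Set.range B) D C) :
    WeaklyOrthogonal L A D (Sum.elim B C) := by
  intro D' E hD hE
  obtain ⟨σ, hσA, hσE⟩ := hM A _ E (Sum.elim B C) hE
  have hσD : SameType L A (σ ∘ D') D := (SameType.of_equiv σ hσA D').symm.trans hD
  have hB : SameType L (A ∪ range B) (σ ∘ D') D :=
    SameType.union_range_iff.2 (h1 _ _ hσD fun _ _ _ _ => Iff.rfl)
  have hC := SameType.union_range_iff.1 (h2 _ _ hB fun _ _ _ _ => Iff.rfl)
  have hDBC := hC.comp (Sum.elim (Sum.inl ∘ Sum.inl)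
    (Sum.elim Sum.inr (Sum.inl ∘ Sum.inr)) : ιD ⊕ ιB ⊕ ιC → (ιD ⊕ ιC) ⊕ ιB)
  have key (c : ιD → M) : Sum.elim (Sum.elim c C) B ∘ (Sum.elim (Sum.inl ∘ Sum.inl)
      (Sum.elim Sum.inr (Sum.inl ∘ Sum.inr)) : ιD ⊕ ιB ⊕ ιC → (ιD ⊕ ιC) ⊕ ιB) =
      Sum.elim c (Sum.elim B C) := by
    ext (i | i | i) <;> rfl
  rw [key, key] at hDBC
  have hE' := SameType.of_equiv σ hσA (Sum.elim D' E)
  rw [Sum.comp_elim, show σ ∘ E = Sum.elim B C from funext hσE] at hE'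
  exact hE'.trans hDBC
end

section
/- Let M be a strongly homogeneous L-structure, A ⊆ M, and (b_i)_{i<α} a construction sequence over A in M, where for each i < α the formula φ_i isolates tp(b_i / A ∪ {b_j : j < i}) and the parameters of φ_i lie in B ∪ {b_j : j ∈ C_i} whenever specified below. Suppose B ⊆ A and X ⊆ α form a construction-closed pair: for every i ∈ X, the parameters of φ_i lie in B ∪ {b_j : j ∈ X, j < i}. Then the tuple (b_i)_{i∈X} is weakly orthogonal to A over B. -/
open FirstOrder FirstOrder.Language Set

universe u v w

namespace SameType

variable {L : FirstOrder.Language.{u, v}} {M : Type w} [L.Structure M]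

theorem mono {ι : Type*} {P Q : Set M} {x y : ι → M} (h : SameType L Q x y) (hPQ : P ⊆ Q) :
    SameType L P x y :=
  fun m ψ q hq => h m ψ q fun k => hPQ (hq k)

/-- A formula cannot distinguish two assignments which, at each of its free variables, either
take corresponding values in the two tuples or agree on a parameter. -/
theorem realize_iff_s10 {ι γ : Type*} {P : Set M} {x y : ι → M} (h : SameType L P x y)
    (ψ : L.Formula γ) [DecidableEq γ] (f g : γ → M)
    (hfg : ∀ c ∈ BoundedFormula.freeVarFinset ψ,
      (∃ i, f c = x i ∧ g c = y i) ∨ (f c = g c ∧ f c ∈ P)) :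
    ψ.Realize f ↔ ψ.Realize g := by
  classical
  let s := BoundedFormula.freeVarFinset ψ
  let T := {c : s // ¬ ∃ i, f c = x i ∧ g c = y i}
  let e : T ≃ Fin (Fintype.card T) := Fintype.equivFin T
  let r : s → ι ⊕ Fin (Fintype.card T) := fun c =>
    if hc : ∃ i, f c = x i ∧ g c = y i then Sum.inl hc.choose else Sum.inr (e ⟨c, hc⟩)
  let q : Fin (Fintype.card T) → M := fun k => f (e.symm k).1
  have hT (c : T) : f c.1 = g c.1 ∧ f c.1 ∈ P := (hfg c.1 c.1.2).resolve_left c.2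
  have hf (c : s) : Sum.elim x q (r c) = f c := by
    by_cases hc : ∃ i, f c = x i ∧ g c = y i
    · simp [r, hc, hc.choose_spec.1.symm]
    · simp [r, hc, q]
  have hg (c : s) : Sum.elim y q (r c) = g c := by
    by_cases hc : ∃ i, f c = x i ∧ g c = y i
    · simp [r, hc, hc.choose_spec.2.symm]
    · simpa [r, hc, q] using (hT ⟨c, hc⟩).1
  have key := h _ (BoundedFormula.restrictFreeVar ψ r) q fun k => (hT (e.symm k)).2
  have hf' := BoundedFormula.realize_restrictFreeVar (φ := ψ) (f := r) (v := Sum.elim x q)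
    (xs := default) f hf
  have hg' := BoundedFormula.realize_restrictFreeVar (φ := ψ) (f := r) (v := Sum.elim y q)
    (xs := default) g hg
  exact hf'.symm.trans (key.trans hg')

/-- Two tuples indexed by a linear order have the same type as soon as all their initial
segments do. -/
theorem of_forall_Iic {κ : Type*} [LinearOrder κ] {P : Set M} {x y : κ → M}
    (h : ∀ i : κ, SameType L P (fun j : Iic i => x j) (fun j : Iic i => y j)) :
    SameType L P x y := by
  classical
  intro m ψ q hq
  let s := BoundedFormula.freeVarFinset ψ
  rcases s.toLeft.eq_empty_or_nonempty with hs | hs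
  · refine realize_iff_s10 (x := (Fin.elim0 : Fin 0 → M)) (y := Fin.elim0) (P := P)
      (fun _ _ _ _ => Iff.rfl) ψ _ _ ?_
    rintro (j | k) hc
    · have : j ∈ s.toLeft := Finset.mem_toLeft.2 hc
      simp [hs] at this
    · exact Or.inr ⟨rfl, hq k⟩
  · refine (h (s.toLeft.max' hs)).realize_iff_s10 ψ _ _ ?_
    rintro (j | k) hc
    · exact Or.inl ⟨⟨j, s.toLeft.le_max' j (Finset.mem_toLeft.2 hc)⟩, rfl, rfl⟩
    · exact Or.inr ⟨rfl, hq k⟩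

theorem comp_equiv_left {ι : Type*} {P : Set M} {x y : ι → M} (σ : M ≃[L] M)
    (hσ : ∀ a ∈ P, σ a = a) : SameType L P (σ ∘ x) y ↔ SameType L P x y := by
  refine forall₄_congr fun m ψ q hq => ?_
  have hq' : Sum.elim (σ ∘ x) q = σ ∘ Sum.elim x q := by
    ext (i | k)
    · rfl
    · exact (hσ _ (hq k)).symm
  rw [hq', StrongHomClass.realize_formula]

/-- If the type of each `y i` over `A` and the earlier entries is isolated by a formula over
`B` and the earlier entries, then `tp(y/B)` implies `tp(y/A)`. -/
theorem of_isolates (hM : StronglyHomogeneous L M) {A B : Set M} (hBA : B ⊆ A)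
    {κ : Type w} [LinearOrder κ] [WellFoundedLT κ] {x y : κ → M}
    {m : κ → ℕ} {φ : ∀ i, L.Formula (Fin 1 ⊕ Fin (m i))} {p : ∀ i, Fin (m i) → M}
    (hiso : ∀ i, Isolates (φ i) (p i) (A ∪ y '' Iio i) ![y i])
    (hp : ∀ i k, p i k ∈ B ∪ y '' Iio i) (h : SameType L B x y) :
    SameType L A x y := by
  classical
  refine of_forall_Iic fun i => ?_
  induction i using WellFoundedLT.induction with
  | ind i ih =>
  have hlt : SameType L A (fun j : Iio i => x j) (fun j : Iio i => y j) := by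
    refine of_forall_Iic fun j m ψ q hq => (ih j j.2).realize_iff_s10 ψ _ _ ?_
    rintro (k | k) -
    · exact Or.inl ⟨⟨k, k.2⟩, rfl, rfl⟩
    · exact Or.inr ⟨rfl, hq k⟩
  obtain ⟨τ, hτA, hτ⟩ := hM A (Iio i) _ _ hlt
  have hx : (φ i).Realize (Sum.elim ![x i] (τ.symm ∘ p i)) := by
    refine (h.realize_iff_s10 (φ i) _ _ ?_).2 (hiso i).1
    rintro (k | k) -
    · exact Or.inl ⟨i, by simp, by simp⟩
    · rcases hp i k with hk | ⟨j, hj, hjk⟩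
      · have : τ.symm (p i k) = p i k := by
          conv_lhs => rw [← hτA _ (hBA hk)]
          exact τ.symm_apply_apply _
        exact Or.inr ⟨this, by simpa [this] using hk⟩
      · refine Or.inl ⟨j, ?_, hjk.symm⟩
        have := hτ ⟨j, hj⟩
        simp only at this
        simp [← hjk, ← this]
  have hτx : (φ i).Realize (Sum.elim ![τ (x i)] (p i)) := by
    rw [← StrongHomClass.realize_formula τ] at hx
    convert hx using 1
    ext (k | k) <;> simp
  have hi := (hiso i).2 _ hτx
  rw [← comp_equiv_left τ hτA]
  intro n ψ q hq
  refine hi.realize_iff_s10 ψ _ _ ?_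
  rintro (⟨j, hj⟩ | k) -
  · rcases (mem_Iic.1 hj).eq_or_lt with rfl | hj
    · exact Or.inl ⟨0, rfl, rfl⟩
    · have := hτ ⟨j, hj⟩
      exact Or.inr ⟨this, Or.inr ⟨j, hj, this.symm⟩⟩
  · exact Or.inr ⟨rfl, Or.inl (hq k)⟩

end SameType

/-- If `(B, X)` is a construction-closed pair (the parameters of `φ_i` for
`i ∈ X` lie in `B ∪ {b_j : j ∈ X, j < i}`), then the tuple `(b_i)_{i ∈ X}` is weakly
orthogonal to `A` over `B`. -/
theorem construction_closed_weaklyOrthogonal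
    {L : FirstOrder.Language.{u, v}} {M : Type w} [L.Structure M]
    (hM : StronglyHomogeneous L M) (A : Set M)
    {ι : Type w} [LinearOrder ι] [WellFoundedLT ι] (b : ι → M)
    (m : ι → ℕ) (φ : ∀ i : ι, L.Formula (Fin 1 ⊕ Fin (m i))) (p : ∀ i : ι, Fin (m i) → M)
    (hiso : ∀ i : ι, Isolates (φ i) (p i) (A ∪ b '' {j | j < i}) ![b i])
    (B : Set M) (hBA : B ⊆ A) (X : Set ι)
    (hparam : ∀ i ∈ X, ∀ k : Fin (m i), p i k ∈ B ∪ b '' {j | j ∈ X ∧ j < i}) :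
    WeaklyOrthogonal L B (fun i : X => b i) (fun a : A => (a : M)) := by
  classical
  intro x a hx ha
  obtain ⟨σ, hσB, hσ⟩ := hM B A a _ ha
  have hσx : SameType L A (σ ∘ x) (fun i : X => b i) := by
    have himage (i : X) : (fun j : X => b j) '' Iio i = b '' {j | j ∈ X ∧ j < i} := by
      ext c
      constructor
      · rintro ⟨j, hj, rfl⟩
        exact ⟨j, ⟨j.2, hj⟩, rfl⟩
      · rintro ⟨j, ⟨hjX, hj⟩, rfl⟩
        exact ⟨⟨j, hjX⟩, hj, rfl⟩
    refine SameType.of_isolates hM hBA (m := fun i : X => m i) (φ := fun i : X => φ i)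
      (p := fun i : X => p i) (fun i => ⟨(hiso i).1, fun c hc => ((hiso i).2 c hc).mono ?_⟩)
      (fun i k => ?_) ((SameType.comp_equiv_left σ hσB).2 hx)
    · rw [himage]
      exact union_subset_union_right A (image_mono fun j hj => hj.2)
    · rw [himage]
      exact hparam i i.2 k
  rw [← SameType.comp_equiv_left σ hσB]
  intro n ψ q hq
  refine hσx.realize_iff_s10 ψ _ _ ?_
  rintro ((i | c) | k) -
  · exact Or.inl ⟨i, rfl, rfl⟩
  · exact Or.inr ⟨hσ c, mem_of_eq_of_mem (hσ c) c.2⟩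
  · exact Or.inr ⟨rfl, hBA (hq k)⟩
end
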